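/- arXiv:1112.1516 — 6 statements merged into one kernel-verified Lean document; each statement's English description precedes it below -/
import Mathlib

section
/- (Theorem 1, canonical form) Let ϱ be a positive semidefinite 4×4 complex matrix with trace 1. If ϱ violates the canonical CHSH inequality, i.e. c_xx(ϱ) + c_xy(ϱ) + c_yx(ϱ) − c_yy(ϱ) > 2, then ϱ also violates the canonical Clifford-polytope facet I_β, i.e. 1 − c_xx(ϱ) − c_xy(ϱ) − c_yx(ϱ) + c_yy(ϱ) + c_zz(ϱ) < 0. -/
open Matrix Kronecker
open scoped ComplexOrder

noncomputable section

/-- The Pauli matrices σx, σy, σz, indexed by `Fin 3` (0 ↦ x, 1 ↦ y, 2 ↦ z). -/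
def pauli : Fin 3 → Matrix (Fin 2) (Fin 2) ℂ :=
  ![!![0, 1; 1, 0], !![0, -Complex.I; Complex.I, 0], !![1, 0; 0, -1]]

/-- Pauli correlation `c_{jk}(ϱ) = Re Tr(ϱ (σj ⊗ σk))` for a two-qubit matrix `ϱ`
(indexed by `Fin 2 × Fin 2`, first qubit is the left Kronecker factor). -/
def corr (j k : Fin 3) (ϱ : Matrix (Fin 2 × Fin 2) (Fin 2 × Fin 2) ℂ) : ℝ :=
  ((ϱ * (pauli j ⊗ₖ pauli k)).trace).re

/-- The correlation `c_zz` of a two-qubit state is at most its trace. -/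
theorem corr_two_two_le_trace {ϱ : Matrix (Fin 2 × Fin 2) (Fin 2 × Fin 2) ℂ}
    (hpsd : ϱ.PosSemidef) : corr 2 2 ϱ ≤ ϱ.trace.re := by
  have h (i : Fin 2 × Fin 2) : 0 ≤ (ϱ i i).re := (Complex.nonneg_iff.mp (hpsd.diag_nonneg)).1
  simp [corr, pauli, Matrix.trace, Matrix.mul_apply, Fintype.sum_prod_type, Fin.sum_univ_two]
  linarith [h (0, 1), h (1, 0)]

/-- Indices: 0 = x, 1 = y, 2 = z. Violation of the canonical CHSH inequality implies
violation of the canonical Clifford-polytope facet `I_β`. -/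
theorem chsh_violation_implies_clifford_facet_violation
    (ϱ : Matrix (Fin 2 × Fin 2) (Fin 2 × Fin 2) ℂ)
    (hpsd : ϱ.PosSemidef) (htr : ϱ.trace = 1)
    (hchsh : corr 0 0 ϱ + corr 0 1 ϱ + corr 1 0 ϱ - corr 1 1 ϱ > 2) :
    1 - corr 0 0 ϱ - corr 0 1 ϱ - corr 1 0 ϱ + corr 1 1 ϱ + corr 2 2 ϱ < 0 := by
  have h := corr_two_two_le_trace hpsd
  rw [htr, Complex.one_re] at h
  linarith
end
end

section
/- (Theorem 1, general form) Let ϱ be a positive semidefinite 4×4 complex matrix with trace 1, let j₁, j₂, j₃ be a permutation of {x, y, z} and k₁, k₂, k₃ a permutation of {x, y, z}, and let s, t, u ∈ {−1, +1}. If the CHSH expression B := s·c_{j₁k₁}(ϱ) + t·c_{j₁k₂}(ϱ) + u·c_{j₂k₁}(ϱ) − s·t·u·c_{j₂k₂}(ϱ) satisfies B > 2, then for every sign ε ∈ {−1, +1} the corresponding Clifford-facet expression is violated: 1 − B + ε·c_{j₃k₃}(ϱ) < 0. -/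
open Matrix Kronecker
open scoped ComplexOrder

noncomputable section

/-- The expectation value of a Hermitian involution in a state is at least `-1`. -/
theorem neg_one_le_trace_mul_re {n : Type*} [Fintype n] [DecidableEq n]
    {ϱ Q : Matrix n n ℂ} (hϱ : ϱ.PosSemidef) (htr : ϱ.trace = 1)
    (hQ : Q.IsHermitian) (hQQ : Q * Q = 1) : -1 ≤ (ϱ * Q).trace.re := by
  have hnonneg : 0 ≤ ((1 + Q)ᴴ * ϱ * (1 + Q)).trace :=
    (hϱ.conjTranspose_mul_mul_same (1 + Q)).trace_nonneg
  have hsq : (1 + Q) * (1 + Q) = (2 : ℂ) • (1 + Q) := by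
    rw [add_mul, mul_add, mul_add, hQQ, two_smul]
    simp only [one_mul, mul_one]
    abel
  rw [(isHermitian_one.add hQ).eq, Matrix.mul_assoc, trace_mul_comm, Matrix.mul_assoc, hsq,
    Matrix.mul_smul, trace_smul, mul_add, mul_one, trace_add, htr] at hnonneg
  have hre := (Complex.le_def.1 hnonneg).1
  simp at hre
  linarith

theorem pauli_isHermitian (j : Fin 3) : (pauli j).IsHermitian := by
  ext a b
  fin_cases j <;> fin_cases a <;> fin_cases b <;> simp [pauli]

theorem pauli_mul_self (j : Fin 3) : pauli j * pauli j = 1 := by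
  ext a b
  fin_cases j <;> fin_cases a <;> fin_cases b <;> simp [pauli, Matrix.mul_apply]

/-- Pauli correlations of a two-qubit state lie in `[-1, 1]`. -/
theorem abs_corr_le_one {ϱ : Matrix (Fin 2 × Fin 2) (Fin 2 × Fin 2) ℂ}
    (hϱ : ϱ.PosSemidef) (htr : ϱ.trace = 1) (j k : Fin 3) : |corr j k ϱ| ≤ 1 := by
  have hH : (pauli j ⊗ₖ pauli k).IsHermitian := by
    rw [IsHermitian, conjTranspose_kronecker, (pauli_isHermitian j).eq, (pauli_isHermitian k).eq]
  have hsq : (pauli j ⊗ₖ pauli k) * (pauli j ⊗ₖ pauli k) = 1 := by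
    rw [← mul_kronecker_mul, pauli_mul_self, pauli_mul_self, one_kronecker_one]
  have hlower := neg_one_le_trace_mul_re hϱ htr hH hsq
  have hupper := neg_one_le_trace_mul_re hϱ htr hH.neg (by rw [neg_mul_neg, hsq])
  rw [mul_neg, trace_neg, Complex.neg_re] at hupper
  exact abs_le.2 ⟨hlower, neg_le_neg_iff.1 hupper⟩

/-- Indices: 0 = x, 1 = y, 2 = z. General form of Theorem 1: violation of any CHSH
inequality (built from distinct Pauli settings `j₁, j₂` on the first side and
`k₁, k₂` on the second, with signs `s, t, u`) implies violation of each corresponding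
Clifford-polytope facet (involving the remaining Paulis `j₃, k₃` with sign `ε`). -/
theorem chsh_violation_implies_clifford_facet_violation_general
    (ϱ : Matrix (Fin 2 × Fin 2) (Fin 2 × Fin 2) ℂ)
    (hpsd : ϱ.PosSemidef) (htr : ϱ.trace = 1)
    (j₁ j₂ j₃ k₁ k₂ k₃ : Fin 3)
    (hj : j₁ ≠ j₂ ∧ j₁ ≠ j₃ ∧ j₂ ≠ j₃) (hk : k₁ ≠ k₂ ∧ k₁ ≠ k₃ ∧ k₂ ≠ k₃)
    (s t u : ℝ) (hs : s = -1 ∨ s = 1) (ht : t = -1 ∨ t = 1) (hu : u = -1 ∨ u = 1)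
    (hB : s * corr j₁ k₁ ϱ + t * corr j₁ k₂ ϱ + u * corr j₂ k₁ ϱ
        - s * t * u * corr j₂ k₂ ϱ > 2) :
    ∀ ε : ℝ, (ε = -1 ∨ ε = 1) →
      1 - (s * corr j₁ k₁ ϱ + t * corr j₁ k₂ ϱ + u * corr j₂ k₁ ϱ
        - s * t * u * corr j₂ k₂ ϱ) + ε * corr j₃ k₃ ϱ < 0 := by
  intro ε hε
  obtain ⟨hlower, hupper⟩ := abs_le.1 (abs_corr_le_one hpsd htr j₃ k₃)
  rcases hε with rfl | rfl <;> linarith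
end
end

section
/- Let n be a natural number, p : Fin n → ℝ with p i ≥ 0 and ∑ p i = 1, and let C i be Clifford unitaries for each i. Then the mixture of Clifford Choi states ϱ = ∑_i p i · (I₂ ⊗ C i) P_Φ (I₂ ⊗ C i)† satisfies the Clifford-polytope facet inequality I_β: 1 − c_xx(ϱ) − c_xy(ϱ) − c_yx(ϱ) + c_yy(ϱ) + c_zz(ϱ) ≥ 0. -/
open Matrix Kronecker
open scoped ComplexOrder

noncomputable section

/-- The projection onto the maximally entangled state `Φ = (|00⟩+|11⟩)/√2`:
entries `1/2` at row/column indices `00` and `11`, zero elsewhere. -/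
def PΦ : Matrix (Fin 2 × Fin 2) (Fin 2 × Fin 2) ℂ :=
  fun i j => if i.1 = i.2 ∧ j.1 = j.2 then 1/2 else 0

/-- A 2×2 unitary `C` is a Clifford unitary if it maps every Pauli matrix to a
signed Pauli matrix under conjugation. -/
def IsClifford (C : Matrix (Fin 2) (Fin 2) ℂ) : Prop :=
  C ∈ Matrix.unitaryGroup (Fin 2) ℂ ∧
    ∀ j : Fin 3, ∃ k : Fin 3, ∃ ε : ℝ, (ε = -1 ∨ ε = 1) ∧
      C * pauli j * Cᴴ = (ε : ℂ) • pauli k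

/-- The product of two Pauli matrices has trace `2` if they agree and `0` otherwise. -/
lemma trace_pauli_mul_pauli (a b : Fin 3) :
    (pauli a * pauli b).trace = if a = b then 2 else 0 := by
  fin_cases a <;> fin_cases b <;>
    simp [pauli, Matrix.trace_fin_two, one_add_one_eq_two]

/-- The trace of a product of three Pauli matrices is `2i` times the Levi-Civita symbol,
written here as a Vandermonde product. -/
lemma trace_pauli_mul_pauli_mul_pauli (a b c : Fin 3) :
    (pauli a * pauli b * pauli c).trace =
      Complex.I * (((b : ℝ) - a) * ((c : ℝ) - b) * ((c : ℝ) - a) : ℝ) := by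
  fin_cases a <;> fin_cases b <;> fin_cases c <;>
    simp [pauli, Matrix.trace_fin_two] <;> ring

lemma transpose_pauli (a : Fin 3) :
    (pauli a)ᵀ = (if a = 1 then -1 else 1 : ℂ) • pauli a := by
  fin_cases a <;> ext i j <;> fin_cases i <;> fin_cases j <;> simp [pauli]

/-- Transpose trick for the maximally entangled state. -/
lemma trace_kronecker_mul_PΦ (A B : Matrix (Fin 2) (Fin 2) ℂ) :
    ((A ⊗ₖ B) * PΦ).trace = 1 / 2 * (Aᵀ * B).trace := by
  simp [Matrix.trace, Matrix.mul_apply, Fintype.sum_prod_type, PΦ]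
  ring

lemma corr_choi (C : Matrix (Fin 2) (Fin 2) ℂ) (j k : Fin 3) :
    corr j k (((1 : Matrix (Fin 2) (Fin 2) ℂ) ⊗ₖ C) * PΦ *
        ((1 : Matrix (Fin 2) (Fin 2) ℂ) ⊗ₖ C)ᴴ) =
      (if j = 1 then -1 else 1) * (1 / 2 * (C * pauli j * Cᴴ * pauli k).trace.re) := by
  have h : ((((1 : Matrix (Fin 2) (Fin 2) ℂ) ⊗ₖ C) * PΦ *
      ((1 : Matrix (Fin 2) (Fin 2) ℂ) ⊗ₖ C)ᴴ) * (pauli j ⊗ₖ pauli k)).trace =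
      1 / 2 * ((pauli j)ᵀ * (Cᴴ * pauli k * C)).trace := by
    have hconj : ((1 : Matrix (Fin 2) (Fin 2) ℂ) ⊗ₖ C)ᴴ * (pauli j ⊗ₖ pauli k) *
        ((1 : Matrix (Fin 2) (Fin 2) ℂ) ⊗ₖ C) = pauli j ⊗ₖ (Cᴴ * pauli k * C) := by
      simp [conjTranspose_kronecker, ← mul_kronecker_mul]
    rw [← trace_kronecker_mul_PΦ, ← hconj, Matrix.mul_assoc, Matrix.trace_mul_comm]
    simp only [← Matrix.mul_assoc]
  have h' : (pauli j * (Cᴴ * pauli k * C)).trace = (C * pauli j * Cᴴ * pauli k).trace := by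
    rw [← Matrix.mul_assoc, Matrix.trace_mul_comm]
    simp only [Matrix.mul_assoc]
  rw [corr, h, transpose_pauli, smul_mul_assoc, Matrix.trace_smul, h']
  split_ifs <;> simp

lemma corr_sum_smul {n : ℕ} (p : Fin n → ℝ)
    (X : Fin n → Matrix (Fin 2 × Fin 2) (Fin 2 × Fin 2) ℂ) (j k : Fin 3) :
    corr j k (∑ i, (p i : ℂ) • X i) = ∑ i, p i * corr j k (X i) := by
  simp [corr, Finset.sum_mul, Matrix.trace_sum]

/-- The facet inequality for a single Clifford Choi state. -/
lemma IsClifford.Ibeta_choi_nonneg {C : Matrix (Fin 2) (Fin 2) ℂ} (hC : IsClifford C)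
    {X : Matrix (Fin 2 × Fin 2) (Fin 2 × Fin 2) ℂ}
    (hX : X = ((1 : Matrix (Fin 2) (Fin 2) ℂ) ⊗ₖ C) * PΦ *
        ((1 : Matrix (Fin 2) (Fin 2) ℂ) ⊗ₖ C)ᴴ) :
    0 ≤ 1 - corr 0 0 X - corr 0 1 X - corr 1 0 X + corr 1 1 X + corr 2 2 X := by
  obtain ⟨hU, hP⟩ := hC
  choose k ε hε hk using hP
  have hcorr (j l : Fin 3) : corr j l X =
      (if j = 1 then -1 else 1) * (if k j = l then ε j else 0) := by
    rw [hX, corr_choi, hk, smul_mul_assoc, Matrix.trace_smul, trace_pauli_mul_pauli]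
    split_ifs <;> simp <;> ring
  have hCC : Cᴴ * C = 1 := Matrix.mem_unitaryGroup_iff'.mp hU
  have hprod : (C * pauli 0 * Cᴴ) * (C * pauli 1 * Cᴴ) * (C * pauli 2 * Cᴴ) =
      C * (pauli 0 * pauli 1 * pauli 2) * Cᴴ := by
    simp only [Matrix.mul_assoc]
    simp only [← Matrix.mul_assoc Cᴴ C, hCC, Matrix.one_mul]
  have horient : ε 0 * ε 1 * ε 2 *
      (((k 1 : ℝ) - k 0) * ((k 2 : ℝ) - k 1) * ((k 2 : ℝ) - k 0)) = 2 := by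
    have h := congrArg Matrix.trace hprod
    rw [Matrix.trace_mul_comm (C * (pauli 0 * pauli 1 * pauli 2)), ← Matrix.mul_assoc Cᴴ, hCC,
      Matrix.one_mul, hk, hk, hk] at h
    simp only [smul_mul_assoc, mul_smul_comm, Matrix.trace_smul,
      trace_pauli_mul_pauli_mul_pauli, smul_eq_mul] at h
    have him := congrArg Complex.im h
    simp at him
    norm_num at him
    linarith
  simp only [hcorr]
  generalize k 0 = a, k 1 = b, k 2 = c at horient ⊢
  rcases hε 0 with h0 | h0 <;> rcases hε 1 with h1 | h1 <;> rcases hε 2 with h2 | h2 <;>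
    rw [h0, h1, h2] at horient <;> simp only [h0, h1, h2] <;>
    fin_cases a <;> fin_cases b <;> fin_cases c <;> norm_num at horient <;> norm_num [Fin.ext_iff]

/-- Indices: 0 = x, 1 = y, 2 = z. Any mixture of Clifford Choi states satisfies the
canonical Clifford-polytope facet inequality `I_β`. -/
theorem clifford_mixture_satisfies_Ibeta
    (n : ℕ) (p : Fin n → ℝ) (hp : ∀ i, 0 ≤ p i) (hsum : ∑ i, p i = 1)
    (C : Fin n → Matrix (Fin 2) (Fin 2) ℂ) (hC : ∀ i, IsClifford (C i))
    (ϱ : Matrix (Fin 2 × Fin 2) (Fin 2 × Fin 2) ℂ)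
    (hϱ : ϱ = ∑ i, (p i : ℂ) •
      (((1 : Matrix (Fin 2) (Fin 2) ℂ) ⊗ₖ C i) * PΦ *
        ((1 : Matrix (Fin 2) (Fin 2) ℂ) ⊗ₖ C i)ᴴ)) :
    1 - corr 0 0 ϱ - corr 0 1 ϱ - corr 1 0 ϱ + corr 1 1 ϱ + corr 2 2 ϱ ≥ 0 := by
  rw [hϱ]
  simp only [corr_sum_smul]
  rw [← hsum, ← Finset.sum_sub_distrib, ← Finset.sum_sub_distrib, ← Finset.sum_sub_distrib,
    ← Finset.sum_add_distrib, ← Finset.sum_add_distrib]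
  refine Finset.sum_nonneg fun i _ => ?_
  have h := mul_nonneg (hp i) ((hC i).Ibeta_choi_nonneg rfl)
  linarith
end
end

section
/- Let s ≥ 0, θ ∈ ℝ and let ϱ = (I₂ ⊗ E₀) P_Φ (I₂ ⊗ E₀)† + (I₂ ⊗ E₁) P_Φ (I₂ ⊗ E₁)† be the Choi–Jamiołkowski state of the dephased phase-gate channel. Then its Pauli correlation table is: c_xx(ϱ) = e^{−s²/2}·cos θ, c_xy(ϱ) = c_yx(ϱ) = e^{−s²/2}·sin θ, c_yy(ϱ) = −e^{−s²/2}·cos θ, c_zz(ϱ) = 1, all remaining correlations c_{jk}(ϱ) with j ≠ k involving z vanish, and all local marginals Re Tr(ϱ (σj ⊗ I₂)) and Re Tr(ϱ (I₂ ⊗ σj)) vanish. -/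
open Matrix Kronecker
open scoped ComplexOrder

noncomputable section

/-- First Kraus operator of the dephased phase gate:
`E₀ = √((1+q)/2)·diag(1, e^{iθ})` with `q = e^{−s²/2}`. -/
def E₀ (s θ : ℝ) : Matrix (Fin 2) (Fin 2) ℂ :=
  (Real.sqrt ((1 + Real.exp (-s ^ 2 / 2)) / 2) : ℂ) •
    !![1, 0; 0, Complex.exp (θ * Complex.I)]

/-- Second Kraus operator of the dephased phase gate:
`E₁ = √((1−q)/2)·diag(1, −e^{iθ})` with `q = e^{−s²/2}`. -/
def E₁ (s θ : ℝ) : Matrix (Fin 2) (Fin 2) ℂ :=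
  (Real.sqrt ((1 - Real.exp (-s ^ 2 / 2)) / 2) : ℂ) •
    !![1, 0; 0, -Complex.exp (θ * Complex.I)]

/-- Trace of a Kronecker product against the Choi matrix of a single diagonal Kraus operator. -/
theorem trace_choi_diagonal_mul_kronecker (c : ℝ) (z : ℂ) (A B : Matrix (Fin 2) (Fin 2) ℂ) :
    (((1 : Matrix (Fin 2) (Fin 2) ℂ) ⊗ₖ ((c : ℂ) • !![1, 0; 0, z])) * PΦ *
      ((1 : Matrix (Fin 2) (Fin 2) ℂ) ⊗ₖ ((c : ℂ) • !![1, 0; 0, z]))ᴴ * (A ⊗ₖ B)).trace =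
    (c : ℂ) ^ 2 / 2 * (A 0 0 * B 0 0 + star z * (A 1 0 * B 1 0) + z * (A 0 1 * B 0 1) +
      z * star z * (A 1 1 * B 1 1)) := by
  simp [Matrix.trace, Matrix.mul_apply, Fintype.sum_prod_type, Fin.sum_univ_two, PΦ,
    Matrix.one_apply]
  ring

/-- Trace of a Kronecker product against the Choi state of the dephased phase gate. -/
theorem trace_dephased_phase_gate_choi_mul_kronecker (s θ : ℝ) (A B : Matrix (Fin 2) (Fin 2) ℂ) :
    ((((1 : Matrix (Fin 2) (Fin 2) ℂ) ⊗ₖ E₀ s θ) * PΦ *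
        ((1 : Matrix (Fin 2) (Fin 2) ℂ) ⊗ₖ E₀ s θ)ᴴ +
      ((1 : Matrix (Fin 2) (Fin 2) ℂ) ⊗ₖ E₁ s θ) * PΦ *
        ((1 : Matrix (Fin 2) (Fin 2) ℂ) ⊗ₖ E₁ s θ)ᴴ) * (A ⊗ₖ B)).trace =
    (A 0 0 * B 0 0 + A 1 1 * B 1 1) / 2 + (Real.exp (-s ^ 2 / 2) : ℂ) / 2 *
      ((Real.cos θ - Real.sin θ * Complex.I) * (A 1 0 * B 1 0) +
        (Real.cos θ + Real.sin θ * Complex.I) * (A 0 1 * B 0 1)) := by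
  have hq : Real.exp (-s ^ 2 / 2) ≤ 1 := Real.exp_le_one_iff.2 (by nlinarith [sq_nonneg s])
  have hp : (Real.sqrt ((1 + Real.exp (-s ^ 2 / 2)) / 2) : ℂ) ^ 2 =
      (1 + (Real.exp (-s ^ 2 / 2) : ℂ)) / 2 := by
    rw [← Complex.ofReal_pow, Real.sq_sqrt (by positivity)]
    push_cast
    rfl
  have hm : (Real.sqrt ((1 - Real.exp (-s ^ 2 / 2)) / 2) : ℂ) ^ 2 =
      (1 - (Real.exp (-s ^ 2 / 2) : ℂ)) / 2 := by
    rw [← Complex.ofReal_pow, Real.sq_sqrt (by linarith)]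
    push_cast
    rfl
  have he : Complex.exp (θ * Complex.I) = Real.cos θ + Real.sin θ * Complex.I := by
    rw [Complex.exp_mul_I, Complex.ofReal_cos, Complex.ofReal_sin]
  have hstar : star (Complex.exp (θ * Complex.I)) = Real.cos θ - Real.sin θ * Complex.I := by
    rw [he]
    simp only [star_add, star_mul', Complex.star_def, Complex.conj_ofReal, Complex.conj_I]
    ring
  have hcs : (Real.cos θ : ℂ) ^ 2 + (Real.sin θ : ℂ) ^ 2 = 1 := by
    exact_mod_cast Real.cos_sq_add_sin_sq θ
  rw [add_mul, Matrix.trace_add, E₀, E₁, trace_choi_diagonal_mul_kronecker,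
    trace_choi_diagonal_mul_kronecker, hp, hm, star_neg, hstar, he]
  linear_combination (A 1 1 * B 1 1 / 2) * hcs -
    (A 1 1 * B 1 1 / 2) * (Real.sin θ : ℂ) ^ 2 * Complex.I_sq

/-- Indices: 0 = x, 1 = y, 2 = z. The Pauli correlation table of the
Choi–Jamiołkowski state of the dephased phase-gate channel. -/
theorem dephased_phase_gate_choi_correlations (s θ : ℝ) (hs : 0 ≤ s)
    (ϱ : Matrix (Fin 2 × Fin 2) (Fin 2 × Fin 2) ℂ)
    (hϱ : ϱ = ((1 : Matrix (Fin 2) (Fin 2) ℂ) ⊗ₖ E₀ s θ) * PΦ *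
        ((1 : Matrix (Fin 2) (Fin 2) ℂ) ⊗ₖ E₀ s θ)ᴴ +
      ((1 : Matrix (Fin 2) (Fin 2) ℂ) ⊗ₖ E₁ s θ) * PΦ *
        ((1 : Matrix (Fin 2) (Fin 2) ℂ) ⊗ₖ E₁ s θ)ᴴ) :
    corr 0 0 ϱ = Real.exp (-s ^ 2 / 2) * Real.cos θ ∧
    corr 0 1 ϱ = Real.exp (-s ^ 2 / 2) * Real.sin θ ∧
    corr 1 0 ϱ = Real.exp (-s ^ 2 / 2) * Real.sin θ ∧
    corr 1 1 ϱ = -(Real.exp (-s ^ 2 / 2) * Real.cos θ) ∧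
    corr 2 2 ϱ = 1 ∧
    corr 0 2 ϱ = 0 ∧ corr 2 0 ϱ = 0 ∧ corr 1 2 ϱ = 0 ∧ corr 2 1 ϱ = 0 ∧
    (∀ j : Fin 3,
      ((ϱ * (pauli j ⊗ₖ (1 : Matrix (Fin 2) (Fin 2) ℂ))).trace).re = 0 ∧
      ((ϱ * ((1 : Matrix (Fin 2) (Fin 2) ℂ) ⊗ₖ pauli j)).trace).re = 0) := by
  subst hϱ
  simp only [corr, trace_dephased_phase_gate_choi_mul_kronecker]
  refine ⟨?_, ?_, ?_, ?_, ?_, ?_, ?_, ?_, ?_, fun j => ?_⟩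
  iterate 9
    simp [pauli, -Complex.ofReal_exp, -Complex.ofReal_cos, -Complex.ofReal_sin]
    try ring_nf
  fin_cases j <;> simp [pauli]
end
end

section
/- Let s ≥ 0, θ = π/4, and let ϱ_s = (I₂ ⊗ E₀) P_Φ (I₂ ⊗ E₀)† + (I₂ ⊗ E₁) P_Φ (I₂ ⊗ E₁)† be the Choi–Jamiołkowski state of the dephased π/4 phase-gate channel. Then the canonical CHSH value is c_xx(ϱ_s) + c_xy(ϱ_s) + c_yx(ϱ_s) − c_yy(ϱ_s) = 2√2·e^{−s²/2}; consequently ϱ_s violates the CHSH inequality (value > 2) if and only if s² < ln 2, and ϱ_s violates the Clifford-polytope facet I_β (i.e. 1 − c_xx − c_xy − c_yx + c_yy + c_zz < 0) if and only if s² < ln 2. -/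
open Matrix Kronecker
open scoped ComplexOrder

noncomputable section

/-- The correlations of `(I ⊗ K) PΦ (I ⊗ K)†` for a diagonal `K = a · diag(1, z)`, `a` real. -/
lemma corr_diagonal_conj_PΦ (a : ℝ) (z : ℂ) (j k : Fin 3) :
    corr j k (((1 : Matrix (Fin 2) (Fin 2) ℂ) ⊗ₖ ((a : ℂ) • !![1, 0; 0, z])) * PΦ *
      ((1 : Matrix (Fin 2) (Fin 2) ℂ) ⊗ₖ ((a : ℂ) • !![1, 0; 0, z]))ᴴ) =
    a ^ 2 * !![z.re, z.im, 0; z.im, -z.re, 0; 0, 0, (1 + Complex.normSq z) / 2] j k := by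
  fin_cases j <;> fin_cases k <;>
    simp [corr, pauli, PΦ, Matrix.trace, Matrix.mul_apply, Fintype.sum_prod_type,
      Matrix.one_apply, Complex.normSq_apply] <;> ring

lemma corr_add (j k : Fin 3) (ϱ τ : Matrix (Fin 2 × Fin 2) (Fin 2 × Fin 2) ℂ) :
    corr j k (ϱ + τ) = corr j k ϱ + corr j k τ := by
  simp [corr, add_mul]

/-- The correlations of the Choi–Jamiołkowski state of the dephased phase gate. -/
lemma corr_dephased_phase_gate (s θ : ℝ) (j k : Fin 3) :
    corr j k (((1 : Matrix (Fin 2) (Fin 2) ℂ) ⊗ₖ E₀ s θ) * PΦ *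
        ((1 : Matrix (Fin 2) (Fin 2) ℂ) ⊗ₖ E₀ s θ)ᴴ +
      ((1 : Matrix (Fin 2) (Fin 2) ℂ) ⊗ₖ E₁ s θ) * PΦ *
        ((1 : Matrix (Fin 2) (Fin 2) ℂ) ⊗ₖ E₁ s θ)ᴴ) =
    !![Real.exp (-s ^ 2 / 2) * Real.cos θ, Real.exp (-s ^ 2 / 2) * Real.sin θ, 0;
      Real.exp (-s ^ 2 / 2) * Real.sin θ, -(Real.exp (-s ^ 2 / 2) * Real.cos θ), 0;
      0, 0, 1] j k := by
  have hq : Real.exp (-s ^ 2 / 2) ≤ 1 := Real.exp_le_one_iff.2 (by nlinarith [sq_nonneg s])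
  have hq0 := Real.exp_pos (-s ^ 2 / 2)
  have hnorm : Complex.normSq (Complex.exp (θ * Complex.I)) = 1 := by
    rw [Complex.normSq_eq_norm_sq, Complex.norm_exp_ofReal_mul_I, one_pow]
  rw [corr_add, E₀, E₁, corr_diagonal_conj_PΦ, corr_diagonal_conj_PΦ,
    Real.sq_sqrt (by linarith), Real.sq_sqrt (by linarith), Complex.normSq_neg, hnorm,
    Complex.neg_re, Complex.neg_im, Complex.exp_ofReal_mul_I_re, Complex.exp_ofReal_mul_I_im]
  fin_cases j <;> fin_cases k <;> simp <;> ring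

lemma two_lt_two_sqrt_two_mul_exp_iff (s : ℝ) :
    2 < 2 * Real.sqrt 2 * Real.exp (-s ^ 2 / 2) ↔ s ^ 2 < Real.log 2 := by
  have h : Real.sqrt 2 = Real.exp (Real.log 2 / 2) := by
    rw [Real.exp_half, Real.exp_log two_pos]
  rw [mul_assoc, h, ← Real.exp_add, lt_mul_iff_one_lt_right two_pos, Real.one_lt_exp_iff]
  constructor <;> intro _ <;> linarith

/-- Indices: 0 = x, 1 = y, 2 = z. For the dephased `π/4` phase gate, the canonical
CHSH value equals `2√2·e^{−s²/2}`; CHSH is violated iff `s² < ln 2`, and the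
Clifford-polytope facet `I_β` is violated iff `s² < ln 2`. -/
theorem dephased_pi_over_four_gate_chsh (s : ℝ) (hs : 0 ≤ s)
    (ϱ : Matrix (Fin 2 × Fin 2) (Fin 2 × Fin 2) ℂ)
    (hϱ : ϱ = ((1 : Matrix (Fin 2) (Fin 2) ℂ) ⊗ₖ E₀ s (Real.pi / 4)) * PΦ *
        ((1 : Matrix (Fin 2) (Fin 2) ℂ) ⊗ₖ E₀ s (Real.pi / 4))ᴴ +
      ((1 : Matrix (Fin 2) (Fin 2) ℂ) ⊗ₖ E₁ s (Real.pi / 4)) * PΦ *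
        ((1 : Matrix (Fin 2) (Fin 2) ℂ) ⊗ₖ E₁ s (Real.pi / 4))ᴴ) :
    corr 0 0 ϱ + corr 0 1 ϱ + corr 1 0 ϱ - corr 1 1 ϱ
        = 2 * Real.sqrt 2 * Real.exp (-s ^ 2 / 2) ∧
    (corr 0 0 ϱ + corr 0 1 ϱ + corr 1 0 ϱ - corr 1 1 ϱ > 2 ↔ s ^ 2 < Real.log 2) ∧
    (1 - corr 0 0 ϱ - corr 0 1 ϱ - corr 1 0 ϱ + corr 1 1 ϱ + corr 2 2 ϱ < 0 ↔
      s ^ 2 < Real.log 2) := by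
  have hval : corr 0 0 ϱ + corr 0 1 ϱ + corr 1 0 ϱ - corr 1 1 ϱ
      = 2 * Real.sqrt 2 * Real.exp (-s ^ 2 / 2) := by
    simp only [hϱ, corr_dephased_phase_gate, Real.cos_pi_div_four, Real.sin_pi_div_four]
    simp
    ring
  have hzz : corr 2 2 ϱ = 1 := by
    rw [hϱ, corr_dephased_phase_gate]
    simp
  have hiff := two_lt_two_sqrt_two_mul_exp_iff s
  rw [← hval] at hiff
  refine ⟨hval, hiff, ?_⟩
  rw [← hiff, hzz]
  constructor <;> intro _ <;> linarith
end
end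

section
/- (Depolarized π/8 gate: UQC-enabling without Bell violation) Let U = diag(1, e^{iπ/4}), and for 0 ≤ p ≤ 1 let ϱ_p = (1−p)·(I₂ ⊗ U) P_Φ (I₂ ⊗ U)† + p·(I₄/4) be the Choi–Jamiołkowski state of the depolarized π/8 gate. If 1 − 1/√2 ≤ p, then every CHSH Bell expression of ϱ_p is at most 2: for all j₁ ≠ j₂, k₁ ≠ k₂ in {x, y, z} and all signs s, t, u ∈ {−1, +1}, s·c_{j₁k₁}(ϱ_p) + t·c_{j₁k₂}(ϱ_p) + u·c_{j₂k₁}(ϱ_p) − s·t·u·c_{j₂k₂}(ϱ_p) ≤ 2. Moreover, if p < (2√2 − 2)/(2√2 − 1), then ϱ_p violates the Clifford-polytope facet I_β: 1 − c_xx(ϱ_p) − c_xy(ϱ_p) − c_yx(ϱ_p) + c_yy(ϱ_p) + c_zz(ϱ_p) < 0. In particular, for 1 − 1/√2 ≤ p < (2√2 − 2)/(2√2 − 1) both conclusions hold simultaneously. -/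
open Matrix Kronecker
open scoped ComplexOrder

noncomputable section

/-- The matrix of Pauli correlations of the depolarized `π/8` gate. -/
lemma corr_depolarized (p : ℝ) (j k : Fin 3) :
    corr j k (((1 - p : ℝ) : ℂ) •
        (((1 : Matrix (Fin 2) (Fin 2) ℂ) ⊗ₖ
            !![1, 0; 0, Complex.exp (Real.pi / 4 * Complex.I)]) * PΦ *
          ((1 : Matrix (Fin 2) (Fin 2) ℂ) ⊗ₖ
            !![1, 0; 0, Complex.exp (Real.pi / 4 * Complex.I)])ᴴ) +
      ((p / 4 : ℝ) : ℂ) • (1 : Matrix (Fin 2 × Fin 2) (Fin 2 × Fin 2) ℂ)) =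
    !![(1 - p) * (√2 / 2), (1 - p) * (√2 / 2), 0;
       (1 - p) * (√2 / 2), -((1 - p) * (√2 / 2)), 0;
       0, 0, 1 - p] j k := by
  have hw : Complex.exp (Real.pi / 4 * Complex.I) =
      ((√2 / 2 : ℝ) : ℂ) + ((√2 / 2 : ℝ) : ℂ) * Complex.I := by
    rw [← Complex.ofReal_ofNat, ← Complex.ofReal_div, Complex.exp_mul_I, ← Complex.ofReal_cos,
      ← Complex.ofReal_sin, Real.cos_pi_div_four, Real.sin_pi_div_four]
  have h2 : (√2 / 2) * (√2 / 2) = 1 / 2 := by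
    rw [div_mul_div_comm, Real.mul_self_sqrt (by norm_num)]
    norm_num
  rw [hw]
  clear hw
  generalize √2 / 2 = r at h2
  fin_cases j <;> fin_cases k <;>
    simp [corr, pauli, PΦ, Matrix.trace, Matrix.mul_apply, Fintype.sum_prod_type,
      Matrix.one_apply] <;>
    grind

/-- Indices: 0 = x, 1 = y, 2 = z. For the depolarized `π/8` gate: if
`1 − 1/√2 ≤ p` then no CHSH inequality with Pauli measurements is violated, while
if `p < (2√2 − 2)/(2√2 − 1)` the Clifford-polytope facet `I_β` is violated; in the
intermediate range both conclusions hold simultaneously. -/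
theorem depolarized_pi_over_eight_gate (p : ℝ) (hp0 : 0 ≤ p) (hp1 : p ≤ 1)
    (U : Matrix (Fin 2) (Fin 2) ℂ)
    (hU : U = !![1, 0; 0, Complex.exp (Real.pi / 4 * Complex.I)])
    (ϱ : Matrix (Fin 2 × Fin 2) (Fin 2 × Fin 2) ℂ)
    (hϱ : ϱ = ((1 - p : ℝ) : ℂ) •
        (((1 : Matrix (Fin 2) (Fin 2) ℂ) ⊗ₖ U) * PΦ *
          ((1 : Matrix (Fin 2) (Fin 2) ℂ) ⊗ₖ U)ᴴ) +
      ((p / 4 : ℝ) : ℂ) • (1 : Matrix (Fin 2 × Fin 2) (Fin 2 × Fin 2) ℂ)) :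
    (1 - 1 / Real.sqrt 2 ≤ p →
      ∀ (j₁ j₂ k₁ k₂ : Fin 3), j₁ ≠ j₂ → k₁ ≠ k₂ →
        ∀ s t u : ℝ, (s = -1 ∨ s = 1) → (t = -1 ∨ t = 1) → (u = -1 ∨ u = 1) →
          s * corr j₁ k₁ ϱ + t * corr j₁ k₂ ϱ + u * corr j₂ k₁ ϱ
            - s * t * u * corr j₂ k₂ ϱ ≤ 2) ∧
    (p < (2 * Real.sqrt 2 - 2) / (2 * Real.sqrt 2 - 1) →
      1 - corr 0 0 ϱ - corr 0 1 ϱ - corr 1 0 ϱ + corr 1 1 ϱ + corr 2 2 ϱ < 0) := by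
  subst hU hϱ
  simp only [corr_depolarized]
  have h2 : √2 * √2 = 2 := Real.mul_self_sqrt (by norm_num)
  have h0 : 0 ≤ √2 := Real.sqrt_nonneg 2
  have h1 : 1 < √2 := by nlinarith
  constructor
  · intro hp
    have ha0 : 0 ≤ (1 - p) * (√2 / 2) := by apply mul_nonneg <;> linarith
    have ha : (1 - p) * (√2 / 2) ≤ 1 / 2 := by
      have hq : 1 - p ≤ 1 / √2 := by linarith
      rw [le_div_iff₀ (by linarith)] at hq
      linarith
    generalize (1 - p) * (√2 / 2) = a at ha0 ha
    intro j₁ j₂ k₁ k₂ hj hk s t u hs ht hu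
    fin_cases j₁ <;> fin_cases j₂ <;> first | exact absurd rfl hj | skip
    all_goals fin_cases k₁ <;> fin_cases k₂ <;> first | exact absurd rfl hk | skip
    all_goals
      rcases hs with rfl | rfl <;> rcases ht with rfl | rfl <;> rcases hu with rfl | rfl <;>
        simp <;> linarith
  · intro hp
    rw [lt_div_iff₀ (by linarith)] at hp
    simp
    linarith
end
end
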